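/- Let R be a commutative Noetherian ring and 𝔞 an ideal of R with ara(𝔞) ≤ 1, i.e. there exists an element x ∈ R such that the radical of the ideal generated by x equals the radical of 𝔞. Then for any R-module M, the local cohomology module H^i_𝔞(M) is 𝔞-cofinite for all i ≥ 0 if and only if Ext^i_R(R/𝔞, M) is a finitely generated R-module for all i ≥ 0. -/

import Mathlib

universe u

open CategoryTheory

/-- The `i`-th Ext module `Ext^i_R(N, M)`. -/
noncomputable def extModule (R : Type u) [CommRing R] (N M : Type u)
    [AddCommGroup N] [Module R N] [AddCommGroup M] [Module R M] (i : ℕ) :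
    ModuleCat.{u} R :=
  ((Ext R (ModuleCat.{u} R) i).obj (Opposite.op (ModuleCat.of R N))).obj (ModuleCat.of R M)

/-- The `i`-th local cohomology module `H^i_𝔞(M)`. -/
noncomputable def localCohomologyModule (R : Type u) [CommRing R] (𝔞 : Ideal R)
    (M : Type u) [AddCommGroup M] [Module R M] (i : ℕ) : ModuleCat.{u} R :=
  (localCohomology 𝔞 i).obj (ModuleCat.of R M)

/-- An `R`-module `M` is `𝔞`-cofinite if `Supp M ⊆ V(𝔞)` and all the modules
`Ext^i_R(R/𝔞, M)` are finitely generated. -/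
def IsCofinite (R : Type u) [CommRing R] (𝔞 : Ideal R)
    (M : Type u) [AddCommGroup M] [Module R M] : Prop :=
  Module.support R M ⊆ PrimeSpectrum.zeroLocus (𝔞 : Set R) ∧
    ∀ i : ℕ, Module.Finite R (extModule R (R ⧸ 𝔞) M i)

/-- An `R`-module `M` is `FD_{<n}` if it has a finitely generated submodule `N` such that
the (Krull) dimension of the support of `M/N` is `< n`. -/
def IsFDLT (R : Type u) [CommRing R] (n : ℕ)
    (M : Type u) [AddCommGroup M] [Module R M] : Prop :=
  ∃ N : Submodule R M, N.FG ∧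
    Order.krullDim (Module.support R (M ⧸ N)) < ((n : ℕ∞) : WithBot ℕ∞)

universe v w

namespace CategoryTheory.ProjectiveResolution

section
variable {D : Type u} [Category.{v} D]

lemma iso_inv_comp_eq_of_comp_hom_eq {X Y Z W : D} (a : X ≅ Y) (b : Z ≅ W) {f : X ⟶ Z}
    {g : Y ⟶ W} (h : f ≫ b.hom = a.hom ≫ g) : a.inv ≫ f = g ≫ b.inv := by
  rw [Iso.inv_comp_eq, ← Category.assoc, Iso.eq_comp_inv]
  exact h

lemma comp_comp_eq_of_comm_sq {X X' Y Y' Z Z' : D} {a : X ⟶ X'} {b : Y ⟶ Y'} {c : Z ⟶ Z'}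
    {p : X ⟶ Y} {p' : X' ⟶ Y'} {q : Y ⟶ Z} {q' : Y' ⟶ Z'} (h₁ : a ≫ p' = p ≫ b)
    (h₂ : b ≫ q' = q ≫ c) : a ≫ p' ≫ q' = (p ≫ q) ≫ c := by
  rw [← Category.assoc, h₁, Category.assoc, h₂, Category.assoc]

end

section
variable {C : Type u} [Category.{v} C] [Abelian C] [HasExt.{w} C] {X Y : C}

lemma extMk_degree_zero_eq_zero (P : ProjectiveResolution X) (f : P.complex.X 0 ⟶ Y) (m : ℕ)
    (hm : 0 + 1 = m) (hf : P.complex.d m 0 ≫ f = 0) (h : P.extMk f m hm hf = 0) : f = 0 := by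
  rw [← P.extEquivCohomologyClass.apply_eq_iff_eq, extEquivCohomologyClass_extMk,
    extEquivCohomologyClass_zero, CochainComplex.HomComplex.CohomologyClass.mk_eq_zero_iff,
    CochainComplex.HomComplex.Cocycle.toSingleMk_mem_coboundaries_iff _ _ _ _ _ (1 : ℤ)
      (by lia)] at h
  obtain ⟨g, hg⟩ := h
  have hd : P.cochainComplex.d (-(0 : ℕ) : ℤ) 1 = 0 :=
    (CochainComplex.isZero_of_isStrictlyLE P.cochainComplex 0 1 (by lia)).eq_of_tgt _ _
  rw [hd, Limits.zero_comp] at hg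
  rw [← cancel_epi (P.cochainComplexXIso (-(0 : ℕ) : ℤ) 0 rfl).hom, ← hg, Limits.comp_zero]

lemma extMk_smul {R : Type*} [Ring R] [Linear R C] (P : ProjectiveResolution X) {n : ℕ}
    (r : R) (f : P.complex.X n ⟶ Y) (m : ℕ)
    (hm : n + 1 = m) (hf : P.complex.d m n ≫ f = 0) :
    P.extMk (r • f) m hm (by simp [hf]) = r • P.extMk f m hm hf := by
  rw [Abelian.Ext.smul_eq_comp_mk₀, extMk_comp_mk₀]
  congr 1
  simp

end

section
variable {R : Type u} [CommRing R] {N N' : ModuleCat.{u} R}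

/-- The class in `Abelian.Ext` of a cocycle, as a linear map. -/
noncomputable def cocycleToExt (P : ProjectiveResolution N) (M : ModuleCat.{u} R) (n : ℕ) :
    LinearMap.ker (Linear.leftComp R M (P.complex.d (n + 1) n)) →ₗ[R] Abelian.Ext N M n where
  toFun f := P.extMk f.1 (n + 1) rfl f.2
  map_add' f g := (P.add_extMk f.1 g.1 (n + 1) rfl f.2 g.2).symm
  map_smul' r f := P.extMk_smul r f.1 (n + 1) rfl f.2

/-- The class in `Abelian.Ext` of a cycle of the complex of homomorphisms. -/
noncomputable def cyclesToExt (P : ProjectiveResolution N) (M : ModuleCat.{u} R) (n : ℕ) :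
    (P.complex.linearYonedaObj R M).cycles n ⟶ ModuleCat.of R (Abelian.Ext N M n) :=
  ModuleCat.ofHom (P.cocycleToExt M n ∘ₗ
    ((P.complex.linearYonedaObj R M).iCycles n).hom.codRestrict
      (LinearMap.ker (Linear.leftComp R M (P.complex.d (n + 1) n))) fun z ↦
        ConcreteCategory.congr_hom ((P.complex.linearYonedaObj R M).iCycles_d n (n + 1)) z)

lemma cyclesToExt_apply (P : ProjectiveResolution N) (M : ModuleCat.{u} R) (n : ℕ)
    (z : (P.complex.linearYonedaObj R M).cycles n) (f : P.complex.X n ⟶ M)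
    (hz : (P.complex.linearYonedaObj R M).iCycles n z = f)
    (hf : P.complex.d (n + 1) n ≫ f = 0) :
    cyclesToExt P M n z = P.extMk f (n + 1) rfl hf := by
  subst hz; rfl

lemma exists_cycle (P : ProjectiveResolution N) (M : ModuleCat.{u} R) (n : ℕ)
    (f : P.complex.X n ⟶ M) (hf : P.complex.d (n + 1) n ≫ f = 0) :
    ∃ z : (P.complex.linearYonedaObj R M).cycles n,
      (P.complex.linearYonedaObj R M).iCycles n z = f :=
  ⟨HomologicalComplex.cyclesMk (P.complex.linearYonedaObj R M) (i := n) f (n + 1) (by simp) hf,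
    HomologicalComplex.i_cyclesMk (P.complex.linearYonedaObj R M) (i := n) f (n + 1) (by simp) hf⟩

lemma exists_toCycles (P : ProjectiveResolution N) (M : ModuleCat.{u} R) (n : ℕ)
    (z : (P.complex.linearYonedaObj R M).cycles n) (hz : cyclesToExt P M n z = 0) :
    ∃ y, (P.complex.linearYonedaObj R M).toCycles ((ComplexShape.up ℕ).prev n) n y = z := by
  have hinj : Function.Injective ((P.complex.linearYonedaObj R M).iCycles n) :=
    (ModuleCat.mono_iff_injective _).mp inferInstance
  have hd : P.complex.d (n + 1) n ≫
    (((P.complex.linearYonedaObj R M).iCycles n z : P.complex.X n ⟶ M)) = 0 :=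
    ConcreteCategory.congr_hom ((P.complex.linearYonedaObj R M).iCycles_d n (n + 1)) z
  rw [cyclesToExt_apply P M n z _ rfl hd] at hz
  cases n with
  | zero =>
    refine ⟨0, ?_⟩
    rw [map_zero]
    apply hinj
    rw [map_zero]
    exact (extMk_degree_zero_eq_zero P _ _ _ hd hz).symm
  | succ p =>
    obtain ⟨g, hg⟩ := (extMk_eq_zero_iff P _ _ _ hd p rfl).mp hz
    have hp : (ComplexShape.up ℕ).prev (p + 1) = p := by simp
    rw [hp]
    exact ⟨g, hinj ((ConcreteCategory.congr_hom
      ((P.complex.linearYonedaObj R M).toCycles_i p (p + 1)) g).trans hg)⟩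

lemma toCycles_cyclesToExt (P : ProjectiveResolution N) (M : ModuleCat.{u} R) (n : ℕ) :
    (P.complex.linearYonedaObj R M).toCycles ((ComplexShape.up ℕ).prev n) n ≫
      cyclesToExt P M n = 0 := by
  cases n with
  | zero =>
    have : (P.complex.linearYonedaObj R M).toCycles ((ComplexShape.up ℕ).prev 0) 0 = 0 := by
      rw [← cancel_mono ((P.complex.linearYonedaObj R M).iCycles 0),
        HomologicalComplex.toCycles_i, Limits.zero_comp]
      exact HomologicalComplex.shape _ _ _ (by simp)
    rw [this, Limits.zero_comp]
  | succ p =>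
    have hp : (ComplexShape.up ℕ).prev (p + 1) = p := by simp
    rw [hp]
    ext y
    have h0 : (P.complex.linearYonedaObj R M).iCycles (p + 1)
      ((P.complex.linearYonedaObj R M).toCycles p (p + 1) y) =
        P.complex.d (p + 1) p ≫ (y : P.complex.X p ⟶ M) := by
      rw [← ConcreteCategory.comp_apply, HomologicalComplex.toCycles_i]
      rfl
    have := cyclesToExt_apply P M (p + 1) _ _ h0
      ((P.complex.d_comp_d_assoc _ _ _ _).trans Limits.zero_comp)
    refine this.trans ?_
    exact (extMk_eq_zero_iff P _ _ _ _ p rfl).mpr ⟨y, rfl⟩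

/-- The comparison of the cohomology of the complex of homomorphisms out of a projective
resolution with `Abelian.Ext`. -/
noncomputable def homologyToExt (P : ProjectiveResolution N) (M : ModuleCat.{u} R) (n : ℕ) :
    (P.complex.linearYonedaObj R M).homology n ⟶ ModuleCat.of R (Abelian.Ext N M n) :=
  ((P.complex.linearYonedaObj R M).homologyIsCokernel _ n rfl).desc
    (Limits.CokernelCofork.ofπ (cyclesToExt P M n) (toCycles_cyclesToExt P M n))

lemma homologyπ_homologyToExt (P : ProjectiveResolution N) (M : ModuleCat.{u} R) (n : ℕ) :
    (P.complex.linearYonedaObj R M).homologyπ n ≫ homologyToExt P M n = cyclesToExt P M n :=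
  ((P.complex.linearYonedaObj R M).homologyIsCokernel _ n rfl).fac _ Limits.WalkingParallelPair.one

lemma homologyToExt_bijective (P : ProjectiveResolution N) (M : ModuleCat.{u} R) (n : ℕ) :
    Function.Bijective (homologyToExt P M n) := by
  have hsurj : Function.Surjective ((P.complex.linearYonedaObj R M).homologyπ n) :=
    (ModuleCat.epi_iff_surjective _).mp inferInstance
  have hπ (z) : homologyToExt P M n ((P.complex.linearYonedaObj R M).homologyπ n z) =
      cyclesToExt P M n z :=
    ConcreteCategory.congr_hom (homologyπ_homologyToExt P M n) z
  constructor
  · refine (injective_iff_map_eq_zero (homologyToExt P M n).hom).mpr fun a ha ↦ ?_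
    obtain ⟨z, rfl⟩ := hsurj a
    obtain ⟨y, rfl⟩ := exists_toCycles P M n z ((hπ z).symm.trans ha)
    rw [← ConcreteCategory.comp_apply, HomologicalComplex.toCycles_comp_homologyπ]
    rfl
  · intro e
    obtain ⟨f, hf, rfl⟩ := P.extMk_surjective e (n + 1) rfl
    obtain ⟨z, hz⟩ := exists_cycle P M n f hf
    exact ⟨_, (hπ z).trans (cyclesToExt_apply P M n z f hz hf)⟩

/-- The map induced on the complexes of homomorphisms to `M`. -/
noncomputable def linearYonedaMap {K L : ChainComplex (ModuleCat.{u} R) ℕ} (φ : K ⟶ L)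
    (M : ModuleCat.{u} R) :
    L.linearYonedaObj R M ⟶ K.linearYonedaObj R M :=
  (HomologicalComplex.unopFunctor (ModuleCat.{u} R) _).map
    (((((linearYoneda R (ModuleCat.{u} R)).obj M).rightOp.mapHomologicalComplex _).map φ).op)

lemma homologyToExt_naturality (P : ProjectiveResolution N) (P' : ProjectiveResolution N')
    (g : N' ⟶ N) (φ : ProjectiveResolution.Hom P' P g) (M : ModuleCat.{u} R) (n : ℕ)
    (a : (P.complex.linearYonedaObj R M).homology n) :
    homologyToExt P' M n (HomologicalComplex.homologyMap (linearYonedaMap φ.hom M) n a) =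
      (Abelian.Ext.mk₀ g).comp (homologyToExt P M n a) (zero_add n) := by
  obtain ⟨z, rfl⟩ : ∃ z, (P.complex.linearYonedaObj R M).homologyπ n z = a :=
    (ModuleCat.epi_iff_surjective _).mp inferInstance a
  have hπ {N : ModuleCat.{u} R} (P : ProjectiveResolution N) (z) :
      homologyToExt P M n ((P.complex.linearYonedaObj R M).homologyπ n z) = cyclesToExt P M n z :=
    ConcreteCategory.congr_hom (homologyπ_homologyToExt P M n) z
  have h1 := ConcreteCategory.congr_hom
    (HomologicalComplex.homologyπ_naturality (linearYonedaMap φ.hom M) n) z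
  rw [ConcreteCategory.comp_apply, ConcreteCategory.comp_apply] at h1
  rw [h1, hπ, hπ]
  have hd : P.complex.d (n + 1) n ≫
    (((P.complex.linearYonedaObj R M).iCycles n z : P.complex.X n ⟶ M)) = 0 :=
    ConcreteCategory.congr_hom ((P.complex.linearYonedaObj R M).iCycles_d n (n + 1)) z
  rw [cyclesToExt_apply P M n z _ rfl hd]
  refine Eq.trans ?_ (mk₀_comp_extMk _ _ _ hd φ).symm
  apply cyclesToExt_apply
  rw [← ConcreteCategory.comp_apply, HomologicalComplex.cyclesMap_i]
  rfl

lemma _root_.HomologicalComplex.homologyMap_unop_comp_homologyUnop_inv {V : Type*} [Category* V]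
    [Limits.HasZeroMorphisms V] {ι : Type*} {c : ComplexShape ι}
    {K L : HomologicalComplex Vᵒᵖ c} (ψ : K ⟶ L) (i : ι) [K.HasHomology i] [L.HasHomology i] :
    (HomologicalComplex.homologyMap ψ i).unop ≫ (K.homologyUnop i).inv =
      (L.homologyUnop i).inv ≫
        HomologicalComplex.homologyMap ((HomologicalComplex.unopFunctor V c).map ψ.op) i := by
  have := HomologicalComplex.homologyOp_hom_naturality
    ((HomologicalComplex.unopFunctor V c).map ψ.op) i
  exact congrArg Quiver.Hom.unop (iso_inv_comp_eq_of_comp_hom_eq _ _ this)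

lemma isoExt_hom_naturality (P : ProjectiveResolution N) (P' : ProjectiveResolution N')
    (g : N' ⟶ N) (φ : ProjectiveResolution.Hom P' P g) (M : ModuleCat.{u} R) (n : ℕ) :
    ((Ext R (ModuleCat.{u} R) n).map g.op).app M ≫ (P'.isoExt (R := R) n M).hom =
      (P.isoExt n M).hom ≫ HomologicalComplex.homologyMap (linearYonedaMap φ.hom M) n := by
  have h := isoLeftDerivedObj_inv_naturality g P' P φ.hom
    (by simpa using φ.hom_f_zero_comp_π_f_zero) ((linearYoneda R (ModuleCat.{u} R)).obj M).rightOp n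
  have h2 := HomologicalComplex.homologyMap_unop_comp_homologyUnop_inv
    ((((linearYoneda R (ModuleCat.{u} R)).obj M).rightOp.mapHomologicalComplex _).map φ.hom) n
  have h' := congrArg Quiver.Hom.unop h
  have := comp_comp_eq_of_comm_sq h' h2
  with_unfolding_all exact this

end
end CategoryTheory.ProjectiveResolution

section
variable {R : Type u} [CommRing R]

/-- The comparison between the two definitions of `Ext` for modules. -/
noncomputable def extLinearEquivAbelianExt (N M : ModuleCat.{u} R) (n : ℕ) :
    ((Ext R (ModuleCat.{u} R) n).obj (Opposite.op N)).obj M ≃ₗ[R] Abelian.Ext N M n :=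
  ((projectiveResolution N).isoExt n M).toLinearEquiv ≪≫ₗ
    LinearEquiv.ofBijective ((projectiveResolution N).homologyToExt M n).hom
      ((projectiveResolution N).homologyToExt_bijective M n)

lemma extLinearEquivAbelianExt_map {N N' : ModuleCat.{u} R} (g : N' ⟶ N) (M : ModuleCat.{u} R)
    (n : ℕ) (a : ((Ext R (ModuleCat.{u} R) n).obj (Opposite.op N)).obj M) :
    extLinearEquivAbelianExt N' M n (((Ext R (ModuleCat.{u} R) n).map g.op).app M a) =
      (Abelian.Ext.mk₀ g).comp (extLinearEquivAbelianExt N M n a) (zero_add n) := by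
  let φ : ProjectiveResolution.Hom (projectiveResolution N') (projectiveResolution N) g :=
    { hom := ProjectiveResolution.lift g _ _
      hom_f_zero_comp_π_f_zero := ProjectiveResolution.lift_commutes_zero g _ _ }
  refine Eq.trans ?_ (ProjectiveResolution.homologyToExt_naturality _ _ g φ M n _)
  exact congrArg ((projectiveResolution N').homologyToExt M n)
    (ConcreteCategory.congr_hom (ProjectiveResolution.isoExt_hom_naturality _ _ g φ M n) a)

end

section
variable {R : Type u} [CommRing R]

lemma Module.Finite.of_exact_of_finite [IsNoetherianRing R] {A B C : Type*} [AddCommGroup A]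
    [Module R A] [AddCommGroup B] [Module R B] [AddCommGroup C] [Module R C]
    [Module.Finite R A] [Module.Finite R C] (f : A →ₗ[R] B) (g : B →ₗ[R] C)
    (h : ∀ b, g b = 0 → ∃ a, f a = b) : Module.Finite R B := by
  have : LinearMap.ker g ≤ LinearMap.range f := fun b hb ↦ h b hb
  have : IsNoetherian R (LinearMap.ker g) := isNoetherian_of_le this
  have := isNoetherian_of_range_eq_ker (LinearMap.ker g).subtype g (by simp)
  infer_instance

lemma ModuleCat.shortExact_of_exact {A B C : Type u} [AddCommGroup A] [Module R A]
    [AddCommGroup B] [Module R B] [AddCommGroup C] [Module R C] {f : A →ₗ[R] B} {g : B →ₗ[R] C}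
    (h : Function.Exact f g) (hf : Function.Injective f) (hg : Function.Surjective g) :
    (ModuleCat.shortComplexOfCompEqZero f g h.linearMap_comp_eq_zero).ShortExact :=
  ModuleCat.shortComplex_shortExact _ h hf hg

namespace CategoryTheory.Abelian.Ext

lemma smul_eq_zero_of_forall_smul_eq_zero {N M : ModuleCat.{u} R} {x : R}
    (hx : ∀ n : N, x • n = 0) {i : ℕ} (ξ : Ext N M i) : x • ξ = 0 := by
  have h : x • 𝟙 N = 0 := by
    ext n
    exact hx n
  rw [← mk₀_id_comp ξ, ← smul_comp, ← mk₀_smul, h, mk₀_zero, zero_comp]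

lemma finite_X₂_left [IsNoetherianRing R] {S : ShortComplex (ModuleCat.{u} R)} (hS : S.ShortExact)
    (M : ModuleCat.{u} R) (i : ℕ) [Module.Finite R (Ext S.X₁ M i)]
    [Module.Finite R (Ext S.X₃ M i)] : Module.Finite R (Ext S.X₂ M i) :=
  .of_exact_of_finite ((mk₀ S.g).precompOfLinear R M (zero_add i))
    ((mk₀ S.f).precompOfLinear R M (zero_add i)) fun x hx ↦ contravariant_sequence_exact₂ hS M x hx

lemma finite_X₃_zero_left [IsNoetherianRing R] {S : ShortComplex (ModuleCat.{u} R)}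
    (hS : S.ShortExact) (M : ModuleCat.{u} R) [Module.Finite R (Ext S.X₂ M 0)] :
    Module.Finite R (Ext S.X₃ M 0) := by
  have := hS.epi_g
  exact .of_injective ((mk₀ S.g).precompOfLinear R M (zero_add 0))
    (precomp_mk₀_injective_of_epi M S.g)

lemma finite_X₃_succ_left [IsNoetherianRing R] {S : ShortComplex (ModuleCat.{u} R)}
    (hS : S.ShortExact) (M : ModuleCat.{u} R) (i : ℕ) [Module.Finite R (Ext S.X₁ M i)]
    [Module.Finite R (Ext S.X₂ M (i + 1))] : Module.Finite R (Ext S.X₃ M (i + 1)) :=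
  .of_exact_of_finite (hS.extClass.precompOfLinear R M (add_comm 1 i))
    ((mk₀ S.g).precompOfLinear R M (zero_add (i + 1)))
    fun x hx ↦ contravariant_sequence_exact₃ hS M x hx (add_comm 1 i)

/-- If all `Ext^i(R/𝔞, M)` are finitely generated, then so is `Ext^i(N, M)` for every finitely
generated module `N` killed by a power of `𝔞`. -/
lemma finite_of_pow_le_annihilator [IsNoetherianRing R] {𝔞 : Ideal R} {M : ModuleCat.{u} R}
    (h : ∀ i, Module.Finite R (Ext (ModuleCat.of R (R ⧸ 𝔞)) M i)) (i : ℕ) {k : ℕ}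
    (N : Type u) [AddCommGroup N] [Module R N] [hN : Module.Finite R N]
    (hk : 𝔞 ^ k ≤ Module.annihilator R N) : Module.Finite R (Ext (ModuleCat.of R N) M i) := by
  induction i using Nat.strong_induction_on generalizing N k with
  | _ i ih
  revert hk
  induction hN using IsNoetherianRing.induction_on_isQuotientEquivQuotientPrime R with
  | subsingleton N =>
    intro _
    have (ξ : Ext (ModuleCat.of R N) M i) : ξ = 0 := by
      rw [← one_smul R ξ, smul_eq_zero_of_forall_smul_eq_zero fun n : N ↦ Subsingleton.elim _ _]
    have : Subsingleton (Ext (ModuleCat.of R N) M i) :=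
      ⟨fun a b ↦ (this a).trans (this b).symm⟩
    infer_instance
  | quotient N p e =>
    intro hk
    rw [e.annihilator_eq, Ideal.annihilator_quotient] at hk
    have hp := p.2.le_of_pow_le hk
    let g : (R ⧸ 𝔞) →ₗ[R] N := e.symm.toLinearMap ∘ₗ Submodule.factor hp
    have hS := LinearMap.shortExact_shortComplexKer (f := g)
      (e.symm.surjective.comp (Submodule.factor_surjective hp))
    cases i with
    | zero =>
      have := h 0
      exact finite_X₃_zero_left hS M
    | succ i =>
      have := h (i + 1)
      have := ih i (by lia) (k := 1) (LinearMap.ker g) (by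
        refine le_trans ?_ (LinearMap.annihilator_le_of_injective (LinearMap.ker g).subtype
          (Submodule.injective_subtype _))
        rw [Ideal.annihilator_quotient, pow_one])
      exact finite_X₃_succ_left hS M i
  | exact N₁ N₂ N₃ f g hf hg hfg h₁ h₃ =>
    intro hk
    have := h₁ (hk.trans (f.annihilator_le_of_injective hf))
    have := h₃ (hk.trans (g.annihilator_le_of_surjective hg))
    exact finite_X₂_left (ModuleCat.shortExact_of_exact hfg hf hg) M i

/-- Evaluation at `1` of a homomorphism out of a cyclic module. -/
noncomputable def evalOne (I : Ideal R) (M : Type u) [AddCommGroup M] [Module R M] :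
    Ext (ModuleCat.of R (R ⧸ I)) (ModuleCat.of R M) 0 →ₗ[R] M :=
  LinearMap.applyₗ (Submodule.mkQ I 1) ∘ₗ (linearEquiv₀.trans ModuleCat.homLinearEquiv).toLinearMap

lemma evalOne_mk₀ (I : Ideal R) {M : Type u} [AddCommGroup M] [Module R M] (f : (R ⧸ I) →ₗ[R] M) :
    evalOne I M (mk₀ (ModuleCat.ofHom f)) = f (Submodule.mkQ I 1) := by
  have : linearEquiv₀ (R := R) (mk₀ (ModuleCat.ofHom f)) = ModuleCat.ofHom f :=
    (linearEquiv₀ (R := R)).apply_symm_apply _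
  simp only [evalOne, LinearMap.comp_apply, LinearEquiv.coe_coe, LinearEquiv.trans_apply, this]
  rfl

lemma exists_eq_mk₀_ofHom {N M : Type u} [AddCommGroup N] [Module R N] [AddCommGroup M]
    [Module R M] (ξ : Ext (ModuleCat.of R N) (ModuleCat.of R M) 0) :
    ∃ f : N →ₗ[R] M, ξ = mk₀ (ModuleCat.ofHom f) :=
  ⟨(linearEquiv₀ (R := R) ξ).hom, (mk₀_linearEquiv₀_apply (R := R) ξ).symm⟩

lemma evalOne_injective (I : Ideal R) (M : Type u) [AddCommGroup M] [Module R M] :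
    Function.Injective (evalOne I M) := by
  refine (injective_iff_map_eq_zero _).mpr fun ξ h ↦ ?_
  obtain ⟨f, rfl⟩ := exists_eq_mk₀_ofHom ξ
  rw [evalOne_mk₀] at h
  have : f = 0 := Submodule.linearMap_qext _ (LinearMap.ext_ring h)
  rw [this, ModuleCat.ofHom_zero, mk₀_zero]

lemma mem_range_evalOne {I : Ideal R} {M : Type u} [AddCommGroup M] [Module R M] {m : M} :
    m ∈ LinearMap.range (evalOne I M) ↔ ∀ a ∈ I, a • m = 0 := by
  constructor
  · rintro ⟨ξ, rfl⟩ a ha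
    have : a • ξ = 0 := smul_eq_zero_of_forall_smul_eq_zero (fun n ↦ by
      obtain ⟨r, rfl⟩ := Submodule.mkQ_surjective I n
      rw [← map_smul]
      exact (Submodule.Quotient.mk_eq_zero I).mpr (I.mul_mem_right _ ha)) ξ
    rw [← map_smul, this, map_zero]
  · intro h
    have h' : I ≤ LinearMap.ker (LinearMap.toSpanSingleton R M m) := h
    refine ⟨mk₀ (ModuleCat.ofHom (Submodule.liftQ I (LinearMap.toSpanSingleton R M m) h')), ?_⟩
    rw [evalOne_mk₀, Submodule.mkQ_apply, Submodule.liftQ_apply, LinearMap.toSpanSingleton_apply,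
      one_smul]

end CategoryTheory.Abelian.Ext

lemma Ideal.shortExact_subtype_mkQ (I : Ideal R) :
    (ModuleCat.shortComplexOfCompEqZero (Submodule.subtype I) (Submodule.mkQ I)
      (LinearMap.exact_subtype_mkQ I).linearMap_comp_eq_zero).ShortExact :=
  ModuleCat.shortExact_of_exact (LinearMap.exact_subtype_mkQ I) (Submodule.injective_subtype I)
    (Submodule.mkQ_surjective I)

/-- Multiplication by `x` on `M` has finitely generated kernel and cokernel. -/
def HasFiniteKerCoker (x : R) (M : Type*) [AddCommGroup M] [Module R M] : Prop :=
  Module.Finite R (LinearMap.ker (LinearMap.lsmul R M x)) ∧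
    Module.Finite R (M ⧸ LinearMap.range (LinearMap.lsmul R M x))

namespace HasFiniteKerCoker
open Abelian

variable {x : R} {M : Type u} [AddCommGroup M] [Module R M]

lemma finite_ext [IsNoetherianRing R] (h : HasFiniteKerCoker x M) {𝔞 : Ideal R} (hx : x ∈ 𝔞)
    (i : ℕ) : Module.Finite R (Ext (ModuleCat.of R (R ⧸ 𝔞)) (ModuleCat.of R M) i) := by
  obtain ⟨h₁, h₂⟩ := h
  let f := (LinearMap.lsmul R M x)
  let X := ModuleCat.of R (R ⧸ 𝔞)
  have hS₁ := LinearMap.shortExact_shortComplexKer f.surjective_rangeRestrict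
  have hS₂ := ModuleCat.shortExact_of_exact (LinearMap.exact_subtype_mkQ (LinearMap.range f))
    (Submodule.injective_subtype _) (Submodule.mkQ_surjective _)
  let α := (Ext.mk₀ (ModuleCat.ofHom f.rangeRestrict)).postcompOfLinear R X (add_zero i)
  let β := (Ext.mk₀ (ModuleCat.ofHom (LinearMap.range f).subtype)).postcompOfLinear R X
    (add_zero i)
  have hβα (ξ) : β (α ξ) = 0 := by
    have h0 : ModuleCat.ofHom f.rangeRestrict ≫ ModuleCat.ofHom (LinearMap.range f).subtype =
      x • 𝟙 (ModuleCat.of R M) := rfl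
    have : x • ξ = 0 := Ext.smul_eq_zero_of_forall_smul_eq_zero (fun n ↦ by
      obtain ⟨r, rfl⟩ := Submodule.mkQ_surjective 𝔞 n
      rw [← map_smul]
      exact (Submodule.Quotient.mk_eq_zero 𝔞).mpr (𝔞.mul_mem_right _ hx)) ξ
    rw [← this]
    refine (Ext.comp_assoc_of_third_deg_zero _ _ _ (add_zero i)).trans ?_
    rw [Ext.mk₀_comp_mk₀, h0, Ext.mk₀_smul, Ext.comp_smul, Ext.comp_mk₀_id]
  have hβ : Module.Finite R (LinearMap.ker β) := by
    cases i with
    | zero =>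
      have := hS₂.mono_f
      have : Function.Injective β := Ext.postcomp_mk₀_injective_of_mono _ _
      rw [LinearMap.ker_eq_bot.mpr this]
      infer_instance
    | succ i =>
      have : LinearMap.ker β ≤
          LinearMap.range (hS₂.extClass.postcompOfLinear R X (rfl : i + 1 = i + 1)) :=
        fun ξ hξ ↦ Ext.covariant_sequence_exact₁ X hS₂ ξ hξ rfl
      have : Module.Finite R (Ext X (ModuleCat.of R (M ⧸ LinearMap.range f)) i) := inferInstance
      have := isNoetherian_of_le ‹LinearMap.ker β ≤ _›
      infer_instance
  have hK : Module.Finite R (LinearMap.ker f.rangeRestrict) := by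
    rwa [LinearMap.ker_rangeRestrict]
  refine .of_exact_of_finite (A := Ext X (ModuleCat.of R (LinearMap.ker f.rangeRestrict)) i)
    ((Ext.mk₀ (ModuleCat.ofHom (LinearMap.ker f.rangeRestrict).subtype)).postcompOfLinear R X
      (add_zero i)) (α.codRestrict (LinearMap.ker β) hβα) fun ξ hξ ↦ ?_
  exact Ext.covariant_sequence_exact₂ X hS₁ ξ (congrArg Subtype.val hξ)

lemma of_finite_ext [IsNoetherianRing R] {𝔞 : Ideal R} {k : ℕ} (hk : 𝔞 ^ k ≤ Ideal.span {x})
    (h : ∀ i, Module.Finite R (Ext (ModuleCat.of R (R ⧸ 𝔞)) (ModuleCat.of R M) i)) :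
    HasFiniteKerCoker x M := by
  let I := Ideal.span {x}
  have h₀ (i : ℕ) : Module.Finite R (Ext (ModuleCat.of R (R ⧸ I)) (ModuleCat.of R M) i) :=
    Ext.finite_of_pow_le_annihilator h i (k := k) (R ⧸ I) (by rwa [Ideal.annihilator_quotient])
  constructor
  · have : LinearMap.ker (LinearMap.lsmul R M x) ≤ LinearMap.range (Ext.evalOne I M) := by
      intro m hm
      refine Ext.mem_range_evalOne.mpr fun a ha ↦ ?_
      obtain ⟨r, rfl⟩ := Ideal.mem_span_singleton'.mp ha
      rw [mul_smul, show x • m = 0 from hm, smul_zero]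
    have := isNoetherian_of_le this
    infer_instance
  · let xM := LinearMap.range (LinearMap.lsmul R M x)
    let x' : I := ⟨x, Ideal.mem_span_singleton_self x⟩
    let p : Ext (ModuleCat.of R I) (ModuleCat.of R M) 0 →ₗ[R] M ⧸ xM :=
      xM.mkQ ∘ₗ LinearMap.applyₗ x' ∘ₗ
        (Ext.linearEquiv₀.trans ModuleCat.homLinearEquiv).toLinearMap
    have hp (f : I →ₗ[R] M) : p (Ext.mk₀ (ModuleCat.ofHom f)) = xM.mkQ (f x') := by
      have : Ext.linearEquiv₀ (R := R) (Ext.mk₀ (ModuleCat.ofHom f)) = ModuleCat.ofHom f :=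
        (Ext.linearEquiv₀ (R := R)).apply_symm_apply _
      simp only [p, LinearMap.comp_apply, LinearEquiv.coe_coe, LinearEquiv.trans_apply, this]
      rfl
    let δ := I.shortExact_subtype_mkQ.extClass.precompOfLinear R (ModuleCat.of R M) (add_zero 1)
    have hδ : LinearMap.ker δ ≤ LinearMap.ker p := by
      intro ξ hξ
      obtain ⟨η, rfl⟩ := Ext.contravariant_sequence_exact₁ I.shortExact_subtype_mkQ _ ξ
        (add_zero 1) hξ
      obtain ⟨f, rfl⟩ := Ext.exists_eq_mk₀_ofHom (N := R) (M := M) η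
      have : (Ext.mk₀ (ModuleCat.ofHom I.subtype)).comp (Ext.mk₀ (ModuleCat.ofHom f))
          (zero_add 0) = Ext.mk₀ (ModuleCat.ofHom (f ∘ₗ I.subtype)) := by
        rw [Ext.mk₀_comp_mk₀]; rfl
      refine (congrArg p this).trans ((hp _).trans ?_)
      refine (Submodule.Quotient.mk_eq_zero xM).mpr ⟨f 1, ?_⟩
      change x • f 1 = f x
      rw [← map_smul, smul_eq_mul, mul_one]
    let A := LinearMap.ker (LinearMap.lsmul R R x)
    have hA : Module.Finite R (A →ₗ[R] M) := by
      have := Ext.finite_of_pow_le_annihilator h 0 (k := k) A (hk.trans <| by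
        rw [Ideal.span_singleton_le_iff_mem, Module.mem_annihilator]
        exact fun a ↦ Subtype.ext a.2)
      exact .equiv (Ext.linearEquiv₀.trans ModuleCat.homLinearEquiv : Ext (ModuleCat.of R A)
        (ModuleCat.of R M) 0 ≃ₗ[R] _)
    let q : M ⧸ xM →ₗ[R] A →ₗ[R] M := xM.liftQ
      ((LinearMap.lsmul R M).compl₁₂ A.subtype LinearMap.id).flip <| by
      rintro _ ⟨m, rfl⟩
      ext a
      change (a : R) • x • m = 0
      rw [smul_smul, mul_comm, show x * a = 0 from a.2, zero_smul]
    have := Module.Finite.equiv δ.quotKerEquivRange.symm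
    refine .of_exact_of_finite ((LinearMap.ker δ).liftQ p hδ) q fun b hb ↦ ?_
    obtain ⟨m, rfl⟩ := Submodule.mkQ_surjective _ b
    let φ := LinearMap.toSpanSingleton R I x'
    have hφ : Function.Surjective φ := by
      rintro ⟨y, hy⟩
      obtain ⟨r, rfl⟩ := Ideal.mem_span_singleton'.mp hy
      exact ⟨r, rfl⟩
    have hφm : LinearMap.ker φ ≤ LinearMap.ker (LinearMap.toSpanSingleton R M m) := by
      intro r hr
      have : x • r = 0 := (mul_comm x r).trans (congrArg Subtype.val hr)
      exact DFunLike.congr_fun hb (⟨r, this⟩ : A)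
    let f : I →ₗ[R] M := (LinearMap.ker φ).liftQ _ hφm ∘ₗ
      (φ.quotKerEquivOfSurjective hφ).symm.toLinearMap
    refine ⟨Submodule.Quotient.mk (Ext.mk₀ (ModuleCat.ofHom f)), ?_⟩
    rw [Submodule.liftQ_apply, hp]
    congr 1
    have : x' = φ.quotKerEquivOfSurjective hφ (Submodule.Quotient.mk 1) :=
      (one_smul R x').symm
    rw [this]
    simp only [f, LinearMap.comp_apply, LinearEquiv.coe_coe, LinearEquiv.symm_apply_apply]
    exact one_smul R m

end HasFiniteKerCoker

end

section
variable {R : Type u} [CommRing R]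

/-- Every element of `K` is killed by a power of `𝔞`. -/
def Ideal.PowTorsion (𝔞 : Ideal R) (K : Type*) [AddCommGroup K] [Module R K] : Prop :=
  ∀ k : K, ∃ n : ℕ, ∀ a ∈ 𝔞 ^ n, a • k = 0

lemma Ideal.PowTorsion.exists_pow_smul_map_eq_zero {𝔞 : Ideal R} {K Z : Type*} [AddCommGroup K]
    [Module R K] [AddCommGroup Z] [Module R Z] [Module.Finite R Z] (hK : 𝔞.PowTorsion K)
    (f : Z →ₗ[R] K) : ∃ n : ℕ, ∀ a ∈ 𝔞 ^ n, ∀ z, a • f z = 0 := by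
  obtain ⟨s, hs⟩ := Module.Finite.fg_top (R := R) (M := Z)
  choose n hn using fun z ↦ hK (f z)
  refine ⟨s.sup n, fun a ha z ↦ ?_⟩
  have : Submodule.span R (s : Set Z) ≤ LinearMap.ker (a • f) :=
    Submodule.span_le.mpr fun y hy ↦ hn y a (Ideal.pow_le_pow_right (Finset.le_sup hy) ha)
  exact this (hs ▸ Submodule.mem_top)

namespace CategoryTheory.Abelian.Ext

lemma mk₀_comp_extClass_comp_eq_zero {C : Type u} [Category.{v} C] [Abelian C] [HasExt.{w} C]
    {S' S : ShortComplex C} (hS' : S'.ShortExact) (hS : S.ShortExact) (φ : S' ⟶ S) {Y : C}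
    {i j : ℕ} (hij : 1 + i = j) (θ : Ext S.X₁ Y i) (hθ : (mk₀ φ.τ₁).comp θ (zero_add i) = 0) :
    (mk₀ φ.τ₃).comp (hS.extClass.comp θ hij) (zero_add j) = 0 := by
  rw [← comp_assoc (a₁₂ := 1) _ _ _ (by lia) (by lia) (by lia),
    ← ShortComplex.ShortExact.extClass_naturality hS' hS φ,
    comp_assoc (a₂₃ := i) _ _ _ (by lia) (by lia) (by lia), hθ, comp_zero]

lemma mk₀_comp_comp_eq_zero {C : Type u} [Category.{v} C] [Abelian C] [HasExt.{w} C]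
    {X Y Z K : C} (f : X ⟶ Y) (g : Y ⟶ Z) {i : ℕ} {ξ : Ext Z K i}
    (h : (mk₀ g).comp ξ (zero_add i) = 0) : (mk₀ (f ≫ g)).comp ξ (zero_add i) = 0 := by
  rw [← mk₀_comp_mk₀_assoc, h, comp_zero]

lemma mk₀_comp_eq_zero_of_range_le {A B : Type u} [AddCommGroup A] [Module R A] [AddCommGroup B]
    [Module R B] {K : ModuleCat.{u} R} {i : ℕ}
    (f : A →ₗ[R] B) (p : Submodule R B) (hf : LinearMap.range f ≤ p)
    (ξ : Ext (ModuleCat.of R B) K i)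
    (hξ : (mk₀ (ModuleCat.ofHom p.subtype)).comp ξ (zero_add i) = 0) :
    (mk₀ (ModuleCat.ofHom f)).comp ξ (zero_add i) = 0 := by
  exact mk₀_comp_comp_eq_zero (ModuleCat.ofHom (f.codRestrict p fun a ↦ hf ⟨a, rfl⟩))
    (ModuleCat.ofHom p.subtype) hξ

lemma exists_pow_smul_comp_eq_zero [IsNoetherianRing R] {𝔞 : Ideal R} {K : Type u}
    [AddCommGroup K] [Module R K] (hK : 𝔞.PowTorsion K) (j : ℕ) (Z : Type u) [AddCommGroup Z]
    [Module R Z] [Module.Finite R Z] (η : Ext (ModuleCat.of R Z) (ModuleCat.of R K) j) :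
    ∃ k : ℕ, (mk₀ (ModuleCat.ofHom (𝔞 ^ k • (⊤ : Submodule R Z)).subtype)).comp η
      (zero_add j) = 0 := by
  induction j generalizing Z with
  | zero =>
    obtain ⟨f, rfl⟩ := exists_eq_mk₀_ofHom η
    obtain ⟨n, hn⟩ := hK.exists_pow_smul_map_eq_zero f
    refine ⟨n, ?_⟩
    have h : f ∘ₗ (𝔞 ^ n • (⊤ : Submodule R Z)).subtype = 0 := by
      have : 𝔞 ^ n • (⊤ : Submodule R Z) ≤ LinearMap.ker f :=
        Submodule.smul_le.mpr fun a ha z _ ↦ by simp [hn a ha z]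
      ext z
      exact this z.2
    rw [mk₀_comp_mk₀, ← ModuleCat.ofHom_comp, h, ModuleCat.ofHom_zero, mk₀_zero]
  | succ j ih =>
    obtain ⟨F, _, _, _, _, f, hf⟩ := Module.exists_finite_presentation R Z
    have hS := LinearMap.shortExact_shortComplexKer hf
    obtain ⟨θ, rfl⟩ := precomp_extClass_surjective_of_projective_X₂ (ModuleCat.of R K) hS j η
    obtain ⟨k, hk⟩ := ih (LinearMap.ker f) θ
    obtain ⟨m, hm⟩ := 𝔞.exists_pow_inf_eq_pow_smul (LinearMap.ker f)
    have hmap : (𝔞 ^ (m + k) • (⊤ : Submodule R F)).map f = 𝔞 ^ (m + k) • ⊤ := by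
      rw [Submodule.map_smul'', Submodule.map_top, LinearMap.range_eq_top.mpr hf]
    let f' : ↥(𝔞 ^ (m + k) • (⊤ : Submodule R F)) →ₗ[R] ↥(𝔞 ^ (m + k) • (⊤ : Submodule R Z)) :=
      f.restrict fun y hy ↦ hmap ▸ Submodule.mem_map_of_mem hy
    have hf' : Function.Surjective f' := by
      rintro ⟨y, hy⟩
      obtain ⟨z, hz, rfl⟩ := hmap.symm ▸ hy
      exact ⟨⟨z, hz⟩, rfl⟩
    have hS' := LinearMap.shortExact_shortComplexKer hf'
    let g : LinearMap.ker f' →ₗ[R] LinearMap.ker f :=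
      ((𝔞 ^ (m + k) • (⊤ : Submodule R F)).subtype ∘ₗ (LinearMap.ker f').subtype).codRestrict _
        fun y ↦ congrArg Subtype.val y.2
    let φ : f'.shortComplexKer ⟶ f.shortComplexKer :=
      { τ₁ := ModuleCat.ofHom g
        τ₂ := ModuleCat.ofHom (Submodule.subtype _)
        τ₃ := ModuleCat.ofHom (Submodule.subtype _)
        comm₁₂ := rfl
        comm₂₃ := rfl }
    refine ⟨m + k, mk₀_comp_extClass_comp_eq_zero hS' hS φ (add_comm 1 j) θ
      (mk₀_comp_eq_zero_of_range_le g _ ?_ θ hk)⟩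
    rintro _ ⟨y, rfl⟩
    have hy : (g y : F) ∈ 𝔞 ^ (m + k) • ⊤ ⊓ LinearMap.ker f := ⟨y.1.2, (g y).2⟩
    rw [hm _ (Nat.le_add_right m k), Nat.add_sub_cancel_left] at hy
    exact (Submodule.mem_smul_top_iff _ _ _).mpr (Submodule.smul_mono le_rfl inf_le_right hy)

/-- Restriction along `R ⧸ J → R ⧸ I`. -/
noncomputable abbrev res {I J : Ideal R} (h : J ≤ I) (M : ModuleCat.{u} R) (i : ℕ) :
    Ext (ModuleCat.of R (R ⧸ I)) M i →ₗ[R] Ext (ModuleCat.of R (R ⧸ J)) M i :=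
  (mk₀ (ModuleCat.ofHom (Submodule.factor h))).precompOfLinear R M (zero_add i)

lemma exists_res_eq_zero [IsNoetherianRing R] {𝔞 : Ideal R} {K : Type u}
    [AddCommGroup K] [Module R K] (hK : 𝔞.PowTorsion K) (j n : ℕ)
    (ξ : Ext (ModuleCat.of R (R ⧸ 𝔞 ^ n)) (ModuleCat.of R K) (j + 1)) :
    ∃ k : ℕ, res (Ideal.pow_le_pow_right (Nat.le_add_right n k)) _ _ ξ = 0 := by
  have hS := (𝔞 ^ n).shortExact_subtype_mkQ
  obtain ⟨θ, rfl⟩ := contravariant_sequence_exact₃ hS _ ξ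
    (eq_zero_of_projective (P := ModuleCat.of R R) _)
    (add_comm 1 j)
  obtain ⟨k, hk⟩ := exists_pow_smul_comp_eq_zero hK j _ θ
  have hS' := (𝔞 ^ (n + k)).shortExact_subtype_mkQ
  have hle : 𝔞 ^ (n + k) ≤ 𝔞 ^ n := Ideal.pow_le_pow_right (Nat.le_add_right n k)
  refine ⟨k, mk₀_comp_extClass_comp_eq_zero hS' hS
      { τ₁ := ModuleCat.ofHom (Submodule.inclusion hle)
        τ₂ := 𝟙 _
        τ₃ := ModuleCat.ofHom (Submodule.factor hle)
        comm₁₂ := rfl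
        comm₂₃ := rfl } _ θ (mk₀_comp_eq_zero_of_range_le _ _ ?_ θ hk)⟩
  rintro _ ⟨y, rfl⟩
  rw [Submodule.mem_smul_top_iff, smul_eq_mul, ← pow_add, add_comm]
  exact y.2

end CategoryTheory.Abelian.Ext
end

section
variable {R : Type u} [CommRing R]

lemma exists_localCohomology_ι (𝔞 : Ideal R) (M : ModuleCat.{u} R) (i : ℕ) :
    ∃ ι : ∀ n, Abelian.Ext (ModuleCat.of R (R ⧸ 𝔞 ^ n)) M i →ₗ[R] (localCohomology 𝔞 i).obj M,
      (∀ n k ξ, ι (n + k) (Abelian.Ext.res (Ideal.pow_le_pow_right (Nat.le_add_right n k)) M i ξ)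
        = ι n ξ) ∧ (∀ t, ∃ n ξ, ι n ξ = t) ∧
      ∀ n ξ, ι n ξ = 0 → ∃ k,
        Abelian.Ext.res (Ideal.pow_le_pow_right (Nat.le_add_right n k)) M i ξ = 0 := by
  let F := localCohomology.diagram (localCohomology.idealPowersDiagram 𝔞) i
  let G := F ⋙ (evaluation (ModuleCat.{u} R) (ModuleCat.{u} R)).obj M
  let c : Limits.Cocone G :=
    ((evaluation (ModuleCat.{u} R) (ModuleCat.{u} R)).obj M).mapCocone (Limits.colimit.cocone F)
  have hc : Limits.IsColimit c := Limits.isColimitOfPreserves _ (Limits.colimit.isColimit F)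
  let e (n : ℕ) : G.obj (.op (.op n)) ≃ₗ[R] Abelian.Ext (ModuleCat.of R (R ⧸ 𝔞 ^ n)) M i :=
    extLinearEquivAbelianExt _ M i
  let s (n k : ℕ) : Opposite.op (Opposite.op n) ⟶ Opposite.op (Opposite.op (n + k)) :=
    (homOfLE (Nat.le_add_right n k)).op.op
  have he (n k : ℕ) (a) : e (n + k) (G.map (s n k) a) =
      Abelian.Ext.res (Ideal.pow_le_pow_right (Nat.le_add_right n k)) M i (e n a) :=
    extLinearEquivAbelianExt_map _ M i a
  let ι (n : ℕ) : Abelian.Ext (ModuleCat.of R (R ⧸ 𝔞 ^ n)) M i →ₗ[R] (localCohomology 𝔞 i).obj M :=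
    (c.ι.app (.op (.op n))).hom ∘ₗ (e n).symm.toLinearMap
  have hι (n : ℕ) (a) : ι n (e n a) = c.ι.app (.op (.op n)) a :=
    congrArg (c.ι.app (.op (.op n))) ((e n).symm_apply_apply a)
  have : IsFiltered ℕᵒᵖᵒᵖ := IsFiltered.of_equivalence (opOpEquivalence ℕ).symm
  have : Limits.PreservesFilteredColimitsOfSize.{0, 0} (forget (ModuleCat.{u} R)) :=
    Limits.preservesFilteredColimitsOfSize_shrink.{0, u, 0, u} _
  have : Limits.PreservesColimitsOfShape ℕᵒᵖᵒᵖ (forget (ModuleCat.{u} R)) :=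
    Limits.PreservesFilteredColimitsOfSize.preserves_filtered_colimits ℕᵒᵖᵒᵖ
  refine ⟨ι, fun n k ξ ↦ ?_, fun t ↦ ?_, fun n ξ h ↦ ?_⟩
  · obtain ⟨a, rfl⟩ := (e n).surjective ξ
    rw [← he, hι, hι]
    exact ConcreteCategory.congr_hom (c.w (s n k)) a
  · obtain ⟨⟨⟨n⟩⟩, a, ha⟩ := Limits.Concrete.isColimit_exists_rep G hc t
    exact ⟨n, e n a, (hι n a).trans ha⟩
  · obtain ⟨a, rfl⟩ := (e n).surjective ξ
    obtain ⟨⟨⟨m⟩⟩, f, g, hfg⟩ := Limits.Concrete.isColimit_exists_of_rep_eq G hc a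
      (0 : G.obj (.op (.op n)))
      (((hι n a).symm.trans h).trans (map_zero (c.ι.app (.op (.op n))).hom).symm)
    obtain ⟨k, rfl⟩ := Nat.exists_eq_add_of_le (leOfHom f.unop.unop)
    have : G.map (s n k) a = 0 := hfg.trans (map_zero (G.map g).hom)
    refine ⟨k, ?_⟩
    rw [← he, this, map_zero]

/-- A module `T` which is a sequential colimit of modules `E n`, given in terms of elements, is
isomorphic to any module with a jointly surjective and eventually injective family of maps. -/
lemma exists_linearEquiv_of_jointly_surjective {E : ℕ → Type*}
    [∀ n, AddCommGroup (E n)] [∀ n, Module R (E n)]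
    (r : ∀ n k, E n →ₗ[R] E (n + k)) {T L : Type*} [AddCommGroup T] [Module R T]
    [AddCommGroup L] [Module R L] (ι : ∀ n, E n →ₗ[R] T) (c : ∀ n, E n →ₗ[R] L)
    (hι : ∀ n k ξ, ι (n + k) (r n k ξ) = ι n ξ) (hc : ∀ n k ξ, c (n + k) (r n k ξ) = c n ξ)
    (hι' : ∀ t, ∃ n ξ, ι n ξ = t) (hc' : ∀ t, ∃ n ξ, c n ξ = t)
    (hι₀ : ∀ n ξ, ι n ξ = 0 → ∃ k, r n k ξ = 0) (hc₀ : ∀ n ξ, c n ξ = 0 → ∃ k, r n k ξ = 0) :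
    Nonempty (T ≃ₗ[R] L) := by
  have hr (n m : ℕ) (η : E m) : ∃ η' : E (n + m), ι (n + m) η' = ι m η ∧ c (n + m) η' = c m η := by
    rw [add_comm n m]
    exact ⟨r m n η, hι _ _ _, hc _ _ _⟩
  have key (n m : ℕ) (ξ : E n) (η : E m) : ι n ξ = ι m η ↔ c n ξ = c m η := by
    obtain ⟨η', h₁, h₂⟩ := hr n m η
    rw [← hι n m, ← hc n m, ← h₁, ← h₂, ← sub_eq_zero, ← sub_eq_zero (a := c _ _), ← map_sub,
      ← map_sub]
    constructor <;> intro h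
    · obtain ⟨k, hk⟩ := hι₀ _ _ h
      rw [← hc _ k, hk, map_zero]
    · obtain ⟨k, hk⟩ := hc₀ _ _ h
      rw [← hι _ k, hk, map_zero]
  choose N Ξ hΞ using hι'
  have hφ (n ξ) : c (N (ι n ξ)) (Ξ (ι n ξ)) = c n ξ := (key _ _ _ _).mp (hΞ _)
  refine ⟨LinearEquiv.ofBijective
    { toFun t := c (N t) (Ξ t)
      map_add' s t := ?_
      map_smul' a t := ?_ } ⟨fun s t h ↦ ?_, fun l ↦ ?_⟩⟩
  · obtain ⟨η', h₁, h₂⟩ := hr (N s) (N t) (Ξ t)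
    rw [← hc (N s) (N t) (Ξ s), ← h₂, ← map_add]
    exact (key _ _ _ _).mp (by rw [hΞ, map_add, hι, h₁, hΞ, hΞ])
  · rw [RingHom.id_apply, ← map_smul]
    exact (key _ _ _ _).mp (by rw [hΞ, map_smul, hΞ])
  · rw [← hΞ s, ← hΞ t]
    exact (key _ _ _ _).mpr h
  · obtain ⟨n, ξ, rfl⟩ := hc' l
    exact ⟨ι n ξ, hφ n ξ⟩

end

section
variable {R : Type u} [CommRing R]

namespace HasFiniteKerCoker

lemma of_subsingleton (x : R) (M : Type*) [AddCommGroup M] [Module R M] [Subsingleton M] :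
    HasFiniteKerCoker x M :=
  ⟨inferInstance, inferInstance⟩

lemma of_linearEquiv {x : R} {M N : Type*} [AddCommGroup M] [Module R M] [AddCommGroup N]
    [Module R N] (e : M ≃ₗ[R] N) (h : HasFiniteKerCoker x M) : HasFiniteKerCoker x N := by
  obtain ⟨h₁, h₂⟩ := h
  constructor
  · refine .of_surjective (e.toLinearMap.restrict (p := LinearMap.ker (LinearMap.lsmul R M x))
      (q := LinearMap.ker (LinearMap.lsmul R N x)) fun m hm ↦ ?_) ?_
    · change x • e m = 0
      rw [← map_smul, show x • m = 0 from hm, map_zero]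
    · rintro ⟨n, hn⟩
      refine ⟨⟨e.symm n, ?_⟩, Subtype.ext (e.apply_symm_apply n)⟩
      change x • e.symm n = 0
      rw [← map_smul, show x • n = 0 from hn, map_zero]
  · refine .of_surjective (Submodule.mapQ (LinearMap.range (LinearMap.lsmul R M x))
      (LinearMap.range (LinearMap.lsmul R N x)) e.toLinearMap ?_) ?_
    · rintro _ ⟨m, rfl⟩
      exact ⟨e m, (map_smul e x m).symm⟩
    · intro n
      obtain ⟨n, rfl⟩ := Submodule.mkQ_surjective _ n
      exact ⟨Submodule.Quotient.mk (e.symm n),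
        congrArg Submodule.Quotient.mk (e.apply_symm_apply n)⟩

lemma iff_ker_and_coker [IsNoetherianRing R] {x : R} {M Q : Type*} [AddCommGroup M] [Module R M]
    [AddCommGroup Q] [Module R Q] (f : M →ₗ[R] Q) (hQ : IsUnit (algebraMap R (Module.End R Q) x)) :
    HasFiniteKerCoker x M ↔
      HasFiniteKerCoker x (LinearMap.ker f) ∧ HasFiniteKerCoker x (Q ⧸ LinearMap.range f) := by
  obtain ⟨u, hu⟩ := hQ.exists_left_inv
  obtain ⟨u', hu'⟩ := hQ.exists_right_inv
  obtain rfl : u = u' := left_inv_eq_right_inv hu hu'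
  replace hu (q : Q) : u (x • q) = q := DFunLike.congr_fun hu q
  replace hu' (q : Q) : x • u q = q := DFunLike.congr_fun hu' q
  have hker {m : M} (hm : x • f m = 0) : f m = 0 := by rw [← hu (f m), hm, map_zero]
  let Γ := LinearMap.ker f
  let H := Q ⧸ LinearMap.range f
  let κ : LinearMap.ker (LinearMap.lsmul R Γ x) →ₗ[R] LinearMap.ker (LinearMap.lsmul R M x) :=
    Γ.subtype.restrict fun m hm ↦ congrArg Subtype.val hm
  have hκ : Function.Bijective κ := by
    refine ⟨fun a b h ↦ Subtype.ext (Subtype.ext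
      (congrArg (LinearMap.ker (LinearMap.lsmul R M x)).subtype h)), fun m ↦ ?_⟩
    have hm : x • (m : M) = 0 := m.2
    exact ⟨⟨⟨m, hker (by rw [← map_smul, hm, map_zero])⟩, Subtype.ext hm⟩, rfl⟩
  let γ : (Γ ⧸ LinearMap.range (LinearMap.lsmul R Γ x)) →ₗ[R]
      M ⧸ LinearMap.range (LinearMap.lsmul R M x) :=
    Submodule.mapQ _ _ Γ.subtype (by rintro _ ⟨m, rfl⟩; exact ⟨m, rfl⟩)
  have hγ : Function.Injective γ := by
    refine (injective_iff_map_eq_zero γ).mpr fun a ha ↦ ?_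
    obtain ⟨a, rfl⟩ := Submodule.mkQ_surjective _ a
    obtain ⟨m, hm⟩ := (Submodule.Quotient.mk_eq_zero _).mp ha
    have hm' : x • m = a := hm
    refine (Submodule.Quotient.mk_eq_zero _).mpr ⟨⟨m, hker ?_⟩, Subtype.ext hm⟩
    rw [← map_smul, hm', show f a = 0 from a.2]
  let δ : (M ⧸ LinearMap.range (LinearMap.lsmul R M x)) →ₗ[R]
      LinearMap.ker (LinearMap.lsmul R H x) :=
    Submodule.liftQ _ (((LinearMap.range f).mkQ ∘ₗ u ∘ₗ f).codRestrict _ fun m ↦ by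
      change x • (LinearMap.range f).mkQ (u (f m)) = 0
      rw [← map_smul, hu']
      exact (Submodule.Quotient.mk_eq_zero _).mpr ⟨m, rfl⟩) <| by
      rintro _ ⟨m, rfl⟩
      refine Subtype.ext ?_
      change (LinearMap.range f).mkQ (u (f (x • m))) = 0
      rw [map_smul, hu]
      exact (Submodule.Quotient.mk_eq_zero _).mpr ⟨m, rfl⟩
  have hδ : Function.Surjective δ := by
    rintro ⟨h, hh⟩
    obtain ⟨q, rfl⟩ := Submodule.mkQ_surjective _ h
    obtain ⟨m, hm⟩ := (Submodule.Quotient.mk_eq_zero (LinearMap.range f) (x := x • q)).mp hh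
    refine ⟨Submodule.Quotient.mk m, Subtype.ext ?_⟩
    change (LinearMap.range f).mkQ (u (f m)) = _
    rw [hm, hu]
  have hγδ (b) (hb : δ b = 0) : ∃ a, γ a = b := by
    obtain ⟨m, rfl⟩ := Submodule.mkQ_surjective _ b
    obtain ⟨m', hm'⟩ := (Submodule.Quotient.mk_eq_zero (LinearMap.range f) (x := u (f m))).mp
      (congrArg Subtype.val hb)
    refine ⟨Submodule.Quotient.mk ⟨m - x • m', ?_⟩, ?_⟩
    · rw [LinearMap.mem_ker, map_sub, map_smul, hm', hu', sub_self]
    · refine (Submodule.Quotient.eq _).mpr ⟨-m', ?_⟩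
      change x • -m' = m - x • m' - m
      rw [smul_neg]
      abel
  constructor
  · rintro ⟨h₁, h₂⟩
    refine ⟨⟨.of_injective κ hκ.1, .of_injective γ hγ⟩, .of_surjective δ hδ, ?_⟩
    have : LinearMap.range (LinearMap.lsmul R H x) = ⊤ := by
      refine LinearMap.range_eq_top.mpr fun h ↦ ?_
      obtain ⟨q, rfl⟩ := Submodule.mkQ_surjective _ h
      exact ⟨Submodule.Quotient.mk (u q), congrArg Submodule.Quotient.mk (hu' q)⟩
    have := Submodule.Quotient.subsingleton_iff.mpr this
    infer_instance
  · rintro ⟨⟨h₁, h₂⟩, h₃, -⟩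
    exact ⟨.of_surjective κ hκ.2, .of_exact_of_finite γ δ hγδ⟩

end HasFiniteKerCoker

lemma Ideal.PowTorsion.of_forall_exists_pow_smul {𝔞 : Ideal R} {x : R} {k : ℕ}
    (hk : 𝔞 ^ k ≤ Ideal.span {x}) {K : Type*} [AddCommGroup K] [Module R K]
    (h : ∀ m : K, ∃ n : ℕ, x ^ n • m = 0) : 𝔞.PowTorsion K := by
  intro m
  obtain ⟨n, hn⟩ := h m
  refine ⟨k * n, fun a ha ↦ ?_⟩
  rw [pow_mul] at ha
  replace ha := Ideal.pow_right_mono hk n ha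
  rw [Ideal.span_singleton_pow] at ha
  obtain ⟨r, rfl⟩ := Ideal.mem_span_singleton'.mp ha
  rw [mul_smul, hn, smul_zero]

namespace CategoryTheory.Abelian.Ext

lemma eq_zero_of_isUnit {x : R} {N Q : Type u} [AddCommGroup N] [Module R N] [AddCommGroup Q]
    [Module R Q] (hx : ∀ n : N, x • n = 0) (hQ : IsUnit (algebraMap R (Module.End R Q) x)) {i : ℕ}
    (ξ : Ext (ModuleCat.of R N) (ModuleCat.of R Q) i) : ξ = 0 := by
  obtain ⟨u, hu⟩ := hQ.exists_right_inv
  have : x • ModuleCat.ofHom u = 𝟙 (ModuleCat.of R Q) := congrArg ModuleCat.ofHom hu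
  rw [← comp_mk₀_id ξ, ← this, mk₀_smul, comp_smul]
  exact smul_eq_zero_of_forall_smul_eq_zero hx _

lemma eq_zero_of_isUnit_of_mem {x : R} {𝔞 : Ideal R} (hx : x ∈ 𝔞) (n : ℕ) {Q : Type u}
    [AddCommGroup Q] [Module R Q] (hQ : IsUnit (algebraMap R (Module.End R Q) x)) {i : ℕ}
    (ξ : Ext (ModuleCat.of R (R ⧸ 𝔞 ^ n)) (ModuleCat.of R Q) i) : ξ = 0 := by
  refine eq_zero_of_isUnit (x := x ^ n) (fun y ↦ ?_) (by rw [map_pow]; exact hQ.pow n) ξ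
  obtain ⟨r, rfl⟩ := Submodule.mkQ_surjective (𝔞 ^ n) y
  rw [← map_smul]
  exact (Submodule.Quotient.mk_eq_zero _).mpr
    ((𝔞 ^ n).mul_mem_right _ (Ideal.pow_mem_pow hx n))

lemma res_comp {I J : Ideal R} (h : J ≤ I) {K L : ModuleCat.{u} R} {i j l : ℕ}
    (ξ : Ext (ModuleCat.of R (R ⧸ I)) K i) (η : Ext K L j) (hl : i + j = l) :
    res h L l (ξ.comp η hl) = (res h K i ξ).comp η hl :=
  (comp_assoc _ _ _ (zero_add i) hl (by lia)).symm

lemma res_res {I J J' : Ideal R} (h : J ≤ I) (h' : J' ≤ J) {K : ModuleCat.{u} R} {i : ℕ}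
    (ξ : Ext (ModuleCat.of R (R ⧸ I)) K i) :
    res h' K i (res h K i ξ) = res (h'.trans h) K i ξ := by
  refine (mk₀_comp_mk₀_assoc _ _ _).trans ?_
  rw [← ModuleCat.ofHom_comp, Submodule.factor_comp]
  rfl

lemma evalOne_res {I J : Ideal R} (h : J ≤ I) {K : Type u} [AddCommGroup K] [Module R K]
    (ξ : Ext (ModuleCat.of R (R ⧸ I)) (ModuleCat.of R K) 0) :
    evalOne J K (res h _ _ ξ) = evalOne I K ξ := by
  obtain ⟨f, rfl⟩ := exists_eq_mk₀_ofHom ξ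
  rw [evalOne_mk₀]
  refine (congrArg (evalOne J K) (mk₀_comp_mk₀ _ _)).trans ?_
  exact evalOne_mk₀ J (f ∘ₗ Submodule.factor h)

/-- The class `ξ` becomes zero in the colimit defining local cohomology. -/
def EventuallyZero {𝔞 : Ideal R} {n : ℕ} {K : ModuleCat.{u} R} {i : ℕ}
    (ξ : Ext (ModuleCat.of R (R ⧸ 𝔞 ^ n)) K i) : Prop :=
  ∃ k, res (Ideal.pow_le_pow_right (Nat.le_add_right n k)) _ _ ξ = 0

namespace EventuallyZero

variable {𝔞 : Ideal R} {n : ℕ} {K L : ModuleCat.{u} R} {i j l : ℕ}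

lemma of_res {k : ℕ} {ξ : Ext (ModuleCat.of R (R ⧸ 𝔞 ^ n)) K i}
    (h : EventuallyZero (res (Ideal.pow_le_pow_right (Nat.le_add_right n k)) _ _ ξ)) :
    EventuallyZero ξ := by
  obtain ⟨m, hm⟩ := h
  rw [res_res] at hm
  refine ⟨k + m, ?_⟩
  have H (N : ℕ) (hN : N = n + (k + m)) (hle : 𝔞 ^ N ≤ 𝔞 ^ n) (h0 : res hle _ _ ξ = 0) :
      res (Ideal.pow_le_pow_right (Nat.le_add_right n (k + m))) _ _ ξ = 0 := by
    subst hN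
    exact h0
  exact H _ (add_assoc _ _ _) _ hm

lemma comp {ξ : Ext (ModuleCat.of R (R ⧸ 𝔞 ^ n)) K i} (h : EventuallyZero ξ) (η : Ext K L j)
    (hl : i + j = l) : EventuallyZero (ξ.comp η hl) := by
  obtain ⟨k, hk⟩ := h
  exact ⟨k, by rw [res_comp, hk, zero_comp]⟩

end EventuallyZero

end CategoryTheory.Abelian.Ext

end

section
variable {R : Type u} [CommRing R]

namespace CategoryTheory.Abelian.Ext

section
variable {𝔞 : Ideal R} {x : R} {n : ℕ} {M Q : Type u} [AddCommGroup M]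
  [Module R M] [AddCommGroup Q] [Module R Q] (f : M →ₗ[R] Q)

lemma shortExact_ker_range : f.rangeRestrict.shortComplexKer.ShortExact :=
  LinearMap.shortExact_shortComplexKer f.surjective_rangeRestrict

lemma shortExact_range_coker :
    (ModuleCat.shortComplexOfCompEqZero (LinearMap.range f).subtype (LinearMap.range f).mkQ
      (LinearMap.exact_subtype_mkQ _).linearMap_comp_eq_zero).ShortExact :=
  ModuleCat.shortExact_of_exact (LinearMap.exact_subtype_mkQ _) (Submodule.injective_subtype _)
    (Submodule.mkQ_surjective _)

variable (hx : x ∈ 𝔞) (hQ : IsUnit (algebraMap R (Module.End R Q) x))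
  (hΓ : 𝔞.PowTorsion (LinearMap.ker f)) (hH : 𝔞.PowTorsion (Q ⧸ LinearMap.range f))

include hΓ in
lemma eventuallyZero_of_comp_rangeRestrict [IsNoetherianRing R] {i : ℕ}
    (ξ : Ext (ModuleCat.of R (R ⧸ 𝔞 ^ n)) (ModuleCat.of R M) (i + 1))
    (h : EventuallyZero (ξ.comp (mk₀ (ModuleCat.ofHom f.rangeRestrict)) (add_zero (i + 1)))) :
    EventuallyZero ξ := by
  obtain ⟨k, hk⟩ := h
  rw [res_comp] at hk
  obtain ⟨η, hη⟩ := covariant_sequence_exact₂ _ (shortExact_ker_range f) _ hk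
  have hΓ' : 𝔞.PowTorsion (LinearMap.ker f.rangeRestrict) := by
    rwa [LinearMap.ker_rangeRestrict]
  have : EventuallyZero η := exists_res_eq_zero hΓ' i _ η
  refine .of_res (k := k) ?_
  rw [← hη]
  exact this.comp _ _

include hx hQ in
lemma exists_comp_extClass_eq {i : ℕ}
    (ξ : Ext (ModuleCat.of R (R ⧸ 𝔞 ^ n)) (ModuleCat.of R (LinearMap.range f)) (i + 1)) :
    ∃ ζ : Ext (ModuleCat.of R (R ⧸ 𝔞 ^ n)) (ModuleCat.of R (Q ⧸ LinearMap.range f)) i,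
      ζ.comp (shortExact_range_coker f).extClass rfl = ξ :=
  covariant_sequence_exact₁ _ (shortExact_range_coker f) ξ (eq_zero_of_isUnit_of_mem hx n hQ _) rfl

include hx hQ hΓ hH in
lemma eventuallyZero_add_two [IsNoetherianRing R] {i : ℕ}
    (ξ : Ext (ModuleCat.of R (R ⧸ 𝔞 ^ n)) (ModuleCat.of R M) (i + 2)) : EventuallyZero ξ := by
  obtain ⟨ζ, hζ⟩ := exists_comp_extClass_eq f hx hQ
    (ξ.comp (mk₀ (ModuleCat.ofHom f.rangeRestrict)) (add_zero (i + 1 + 1)))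
  have h : EventuallyZero ζ := exists_res_eq_zero hH i _ ζ
  refine eventuallyZero_of_comp_rangeRestrict f hΓ ξ ?_
  rw [← hζ]
  exact h.comp _ _

include hx hQ in
lemma bijective_comp_extClass :
    Function.Bijective ((shortExact_range_coker f).extClass.postcompOfLinear R
      (ModuleCat.of R (R ⧸ 𝔞 ^ n)) (rfl : 0 + 1 = 1)) := by
  refine ⟨(injective_iff_map_eq_zero _).mpr fun ζ hζ ↦ ?_,
    fun ξ ↦ exists_comp_extClass_eq f hx hQ ξ⟩
  obtain ⟨θ, rfl⟩ := covariant_sequence_exact₃ _ (shortExact_range_coker f) ζ rfl hζ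
  have : θ = 0 := eq_zero_of_isUnit_of_mem hx n hQ θ
  rw [this, zero_comp]

/-- The connecting homomorphism sends `Ext^1(R/𝔞^n, M)` to `Q / f(M)`. -/
noncomputable def toCoker (n : ℕ) :
    Ext (ModuleCat.of R (R ⧸ 𝔞 ^ n)) (ModuleCat.of R M) 1 →ₗ[R] Q ⧸ LinearMap.range f :=
  evalOne (𝔞 ^ n) _ ∘ₗ
    (LinearEquiv.ofBijective _ (bijective_comp_extClass (n := n) f hx hQ)).symm.toLinearMap ∘ₗ
      (mk₀ (ModuleCat.ofHom f.rangeRestrict)).postcompOfLinear R (ModuleCat.of R (R ⧸ 𝔞 ^ n))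
        (add_zero 1)

lemma toCoker_eq {ξ : Ext (ModuleCat.of R (R ⧸ 𝔞 ^ n)) (ModuleCat.of R M) 1}
    {ζ : Ext (ModuleCat.of R (R ⧸ 𝔞 ^ n)) (ModuleCat.of R (Q ⧸ LinearMap.range f)) 0}
    (h : ζ.comp (shortExact_range_coker f).extClass rfl =
      ξ.comp (mk₀ (ModuleCat.ofHom f.rangeRestrict)) (add_zero 1)) :
    toCoker f hx hQ n ξ = evalOne (𝔞 ^ n) _ ζ :=
  congrArg (evalOne (𝔞 ^ n) _) ((LinearEquiv.symm_apply_eq _).mpr h.symm)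

end
end CategoryTheory.Abelian.Ext

open Abelian in
lemma subsingleton_localCohomology_of_eventuallyZero {𝔞 : Ideal R} {M : ModuleCat.{u} R} {i : ℕ}
    (h : ∀ n (ξ : Ext (ModuleCat.of R (R ⧸ 𝔞 ^ n)) M i), ξ.EventuallyZero) :
    Subsingleton ((localCohomology 𝔞 i).obj M) := by
  obtain ⟨ι, hι, hι', -⟩ := exists_localCohomology_ι 𝔞 M i
  refine subsingleton_of_forall_eq 0 fun t ↦ ?_
  obtain ⟨n, ξ, rfl⟩ := hι' t
  obtain ⟨k, hk⟩ := h n ξ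
  rw [← hι n k, hk, map_zero]

section
variable {𝔞 : Ideal R} {x : R} {M Q : Type u} [AddCommGroup M]
  [Module R M] [AddCommGroup Q] [Module R Q] (f : M →ₗ[R] Q)
  (hx : x ∈ 𝔞) (hQ : IsUnit (algebraMap R (Module.End R Q) x))
  (hΓ : 𝔞.PowTorsion (LinearMap.ker f)) (hH : 𝔞.PowTorsion (Q ⧸ LinearMap.range f))

include hx hQ hΓ in
open Abelian in
lemma localCohomology_zero_equiv_ker :
    Nonempty ((localCohomology 𝔞 0).obj (ModuleCat.of R M) ≃ₗ[R] LinearMap.ker f) := by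
  obtain ⟨ι, hι, hι', hι₀⟩ := exists_localCohomology_ι 𝔞 (ModuleCat.of R M) 0
  have hmem (n : ℕ) (ξ : Ext (ModuleCat.of R (R ⧸ 𝔞 ^ n)) (ModuleCat.of R M) 0) :
      Ext.evalOne (𝔞 ^ n) M ξ ∈ LinearMap.ker f := by
    have h : x ^ n • Ext.evalOne (𝔞 ^ n) M ξ = 0 :=
      Ext.mem_range_evalOne.mp ⟨ξ, rfl⟩ _ (Ideal.pow_mem_pow hx n)
    obtain ⟨u, hu⟩ := (hQ.pow n).exists_left_inv
    rw [← map_pow] at hu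
    have h' : algebraMap R (Module.End R Q) (x ^ n) (f (Ext.evalOne (𝔞 ^ n) M ξ)) = 0 := by
      rw [Module.algebraMap_end_apply, ← map_smul, h, map_zero]
    have := DFunLike.congr_fun hu (f (Ext.evalOne (𝔞 ^ n) M ξ))
    rw [Module.End.mul_apply, h', map_zero] at this
    exact this.symm
  refine exists_linearEquiv_of_jointly_surjective (fun n k ↦
    Ext.res (Ideal.pow_le_pow_right (Nat.le_add_right n k)) (ModuleCat.of R M) 0) ι
    (fun n ↦ (Ext.evalOne (𝔞 ^ n) M).codRestrict _ (hmem n)) hι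
    (fun n k ξ ↦ Subtype.ext (Ext.evalOne_res _ ξ)) hι' (fun t ↦ ?_) hι₀ fun n ξ h ↦ ?_
  · obtain ⟨n, hn⟩ := hΓ t
    obtain ⟨ξ, hξ⟩ := Ext.mem_range_evalOne.mpr fun a ha ↦ congrArg Subtype.val (hn a ha)
    exact ⟨n, ξ, Subtype.ext hξ⟩
  · have : ξ = 0 := Ext.evalOne_injective _ _ <|
      (congrArg Subtype.val h).trans (map_zero (Ext.evalOne (𝔞 ^ n) M)).symm
    exact ⟨0, by rw [this, map_zero]⟩

include hx hQ hΓ hH in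
open Abelian in
lemma localCohomology_one_equiv_coker [IsNoetherianRing R] :
    Nonempty ((localCohomology 𝔞 1).obj (ModuleCat.of R M) ≃ₗ[R] Q ⧸ LinearMap.range f) := by
  obtain ⟨ι, hι, hι', hι₀⟩ := exists_localCohomology_ι 𝔞 (ModuleCat.of R M) 1
  refine exists_linearEquiv_of_jointly_surjective (fun n k ↦
    Ext.res (Ideal.pow_le_pow_right (Nat.le_add_right n k)) (ModuleCat.of R M) 1) ι
    (Ext.toCoker f hx hQ) hι (fun n k ξ ↦ ?_) hι' (fun t ↦ ?_) hι₀ fun n ξ h ↦ ?_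
  · obtain ⟨ζ, hζ⟩ := Ext.exists_comp_extClass_eq f hx hQ
      (ξ.comp (Ext.mk₀ (ModuleCat.ofHom f.rangeRestrict)) (add_zero 1))
    rw [Ext.toCoker_eq f hx hQ hζ, Ext.toCoker_eq f hx hQ
      (ζ := Ext.res (Ideal.pow_le_pow_right (Nat.le_add_right n k)) _ _ ζ), Ext.evalOne_res]
    rw [← Ext.res_comp, ← Ext.res_comp, hζ]
  · obtain ⟨n, hn⟩ := hH t
    obtain ⟨ζ, rfl⟩ := Ext.mem_range_evalOne.mpr hn
    have hΓ' : 𝔞.PowTorsion (LinearMap.ker f.rangeRestrict) := by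
      rwa [LinearMap.ker_rangeRestrict]
    let θ := ζ.comp (Ext.shortExact_range_coker f).extClass (rfl : 0 + 1 = 1)
    obtain ⟨k, hk⟩ := Ext.exists_res_eq_zero hΓ' 1 n
      (θ.comp (Ext.shortExact_ker_range f).extClass (rfl : 1 + 1 = 2))
    rw [Ext.res_comp] at hk
    obtain ⟨ξ, hξ⟩ := Ext.covariant_sequence_exact₃ _ (Ext.shortExact_ker_range f) _ rfl hk
    refine ⟨n + k, ξ, (Ext.toCoker_eq f hx hQ
      (ζ := Ext.res (Ideal.pow_le_pow_right (Nat.le_add_right n k)) _ _ ζ) ?_).trans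
        (Ext.evalOne_res _ _)⟩
    rw [← Ext.res_comp]
    exact hξ.symm
  · obtain ⟨ζ, hζ⟩ := Ext.exists_comp_extClass_eq f hx hQ
      (ξ.comp (Ext.mk₀ (ModuleCat.ofHom f.rangeRestrict)) (add_zero 1))
    rw [Ext.toCoker_eq f hx hQ hζ] at h
    have : ζ = 0 := Ext.evalOne_injective _ _ (h.trans (map_zero _).symm)
    refine Ext.eventuallyZero_of_comp_rangeRestrict f hΓ ξ ?_
    rw [← hζ, this, Ext.zero_comp]
    exact ⟨0, map_zero _⟩

end

lemma support_localCohomology_subset (𝔞 : Ideal R) (M : ModuleCat.{u} R) (i : ℕ) :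
    Module.support R ((localCohomology 𝔞 i).obj M) ⊆ PrimeSpectrum.zeroLocus (𝔞 : Set R) := by
  intro p hp
  obtain ⟨t, ht⟩ := Module.mem_support_iff_exists_annihilator.mp hp
  obtain ⟨ι, -, hι', -⟩ := exists_localCohomology_ι 𝔞 M i
  obtain ⟨n, ξ, rfl⟩ := hι' t
  have : 𝔞 ^ n ≤ p.asIdeal := by
    refine le_trans (fun a ha ↦ ?_) ht
    rw [Submodule.mem_annihilator_span_singleton, ← map_smul,
      Abelian.Ext.smul_eq_zero_of_forall_smul_eq_zero, map_zero]
    intro y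
    obtain ⟨r, rfl⟩ := Submodule.mkQ_surjective (𝔞 ^ n) y
    rw [← map_smul]
    exact (Submodule.Quotient.mk_eq_zero _).mpr ((𝔞 ^ n).mul_mem_right _ ha)
  exact p.2.le_of_pow_le this

section
variable [IsNoetherianRing R] {𝔞 : Ideal R} {x : R} {k : ℕ} (hx : x ∈ 𝔞)
  (hk : 𝔞 ^ k ≤ Ideal.span {x}) {M : Type u} [AddCommGroup M] [Module R M]

include hx hk in
lemma hasFiniteKerCoker_iff_localCohomology :
    HasFiniteKerCoker x M ↔
      ∀ i, HasFiniteKerCoker x ((localCohomology 𝔞 i).obj (ModuleCat.of R M)) := by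
  let S := Submonoid.powers x
  let f := LocalizedModule.mkLinearMap S M
  have hQ : IsUnit (algebraMap R (Module.End R (LocalizedModule S M)) x) :=
    IsLocalizedModule.map_units f (⟨x, Submonoid.mem_powers x⟩ : S)
  have hΓ : 𝔞.PowTorsion (LinearMap.ker f) := by
    refine .of_forall_exists_pow_smul hk fun m ↦ ?_
    obtain ⟨⟨_, n, rfl⟩, hn⟩ := (IsLocalizedModule.eq_zero_iff S f).mp m.2
    exact ⟨n, Subtype.ext hn⟩
  have hH : 𝔞.PowTorsion (LocalizedModule S M ⧸ LinearMap.range f) := by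
    refine .of_forall_exists_pow_smul hk fun h ↦ ?_
    obtain ⟨q, rfl⟩ := Submodule.mkQ_surjective _ h
    obtain ⟨⟨m, ⟨_, n, rfl⟩⟩, hn⟩ := IsLocalizedModule.surj S f q
    exact ⟨n, (Submodule.Quotient.mk_eq_zero _).mpr ⟨m, hn.symm⟩⟩
  obtain ⟨e₀⟩ := localCohomology_zero_equiv_ker f hx hQ hΓ
  obtain ⟨e₁⟩ := localCohomology_one_equiv_coker f hx hQ hΓ hH
  rw [HasFiniteKerCoker.iff_ker_and_coker f hQ]
  refine ⟨fun h i ↦ ?_, fun h ↦ ⟨.of_linearEquiv e₀ (h 0), .of_linearEquiv e₁ (h 1)⟩⟩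
  match i with
  | 0 => exact .of_linearEquiv e₀.symm h.1
  | 1 => exact .of_linearEquiv e₁.symm h.2
  | i + 2 =>
    have : Subsingleton ((localCohomology 𝔞 (i + 2)).obj (ModuleCat.of R M)) :=
      subsingleton_localCohomology_of_eventuallyZero fun n ξ ↦
        Abelian.Ext.eventuallyZero_add_two f hx hQ hΓ hH ξ
    exact .of_subsingleton x _

include hx hk in
lemma hasFiniteKerCoker_iff_finite_ext :
    HasFiniteKerCoker x M ↔ ∀ i, Module.Finite R
      (((Ext R (ModuleCat.{u} R) i).obj (.op (ModuleCat.of R (R ⧸ 𝔞)))).obj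
        (ModuleCat.of R M)) := by
  have h (i : ℕ) := Module.Finite.equiv_iff
    (extLinearEquivAbelianExt (ModuleCat.of R (R ⧸ 𝔞)) (ModuleCat.of R M) i)
  simp only [h]
  exact ⟨fun h i ↦ h.finite_ext hx i, fun h ↦ .of_finite_ext hk h⟩

end

lemma Ideal.exists_mem_and_pow_le_of_radical_eq [IsNoetherianRing R] {𝔞 : Ideal R} {x : R}
    (hx : (Ideal.span {x}).radical = 𝔞.radical) :
    ∃ y ∈ 𝔞, ∃ k, 𝔞 ^ k ≤ Ideal.span {y} := by
  obtain ⟨n, hn⟩ : x ∈ 𝔞.radical := hx ▸ Ideal.le_radical (Ideal.mem_span_singleton_self x)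
  have hle : 𝔞 ≤ (Ideal.span {x}).radical := hx ▸ Ideal.le_radical
  obtain ⟨k, hk⟩ := Ideal.exists_pow_le_of_le_radical_of_fg hle
    (IsNoetherian.noetherian 𝔞)
  refine ⟨x ^ n, hn, k * n, ?_⟩
  rw [pow_mul, ← Ideal.span_singleton_pow]
  exact Ideal.pow_right_mono hk n

end

/-- Theorem 3.4, case (a): if `ara 𝔞 ≤ 1`, then all `H^i_𝔞(M)` are `𝔞`-cofinite iff all
`Ext^i_R(R/𝔞, M)` are finitely generated. -/
theorem localCohomology_isCofinite_iff_ext_finite_of_ara_le_one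
    (R : Type u) [CommRing R] [IsNoetherianRing R] (𝔞 : Ideal R)
    (hara : ∃ x : R, (Ideal.span {x}).radical = 𝔞.radical)
    (M : Type u) [AddCommGroup M] [Module R M] :
    (∀ i : ℕ, IsCofinite R 𝔞 (localCohomologyModule R 𝔞 M i)) ↔
      (∀ i : ℕ, Module.Finite R (extModule R (R ⧸ 𝔞) M i)) := by
  obtain ⟨x, hx⟩ := hara
  obtain ⟨y, hy, k, hk⟩ := Ideal.exists_mem_and_pow_le_of_radical_eq hx
  refine Iff.trans (forall_congr' fun i ↦ ?_)
    ((hasFiniteKerCoker_iff_localCohomology hy hk).symm.trans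
      (hasFiniteKerCoker_iff_finite_ext hy hk))
  exact (and_iff_right (support_localCohomology_subset 𝔞 (ModuleCat.of R M) i)).trans
    (hasFiniteKerCoker_iff_finite_ext hy hk).symm
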